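/- Let n ≥ 1, d ≥ 1 and let h ∈ ℂ[x_0,…,x_n] be a nonzero harmonic homogeneous polynomial of degree d with rk(h) = r. Suppose there exist linear forms ℓ_1,…,ℓ_r with h = ℓ_1^d + … + ℓ_r^d such that ℓ_1,…,ℓ_k are isotropic for some 0 ≤ k ≤ r (i.e., some minimal Waring decomposition of h contains k isotropic linear forms). Then irk(h) ≤ 2·rk(h) − k. -/

import Mathlib

open MvPolynomial

/-- The linear form with coefficient vector `a`. -/
noncomputable def lin {n : ℕ} (a : Fin n → ℂ) : MvPolynomial (Fin n) ℂ :=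
  ∑ i, MvPolynomial.C (a i) * MvPolynomial.X i

/-- The Laplace operator `Δ = ∑ ∂²/∂xᵢ²`. -/
noncomputable def lap {n : ℕ} (p : MvPolynomial (Fin n) ℂ) : MvPolynomial (Fin n) ℂ :=
  ∑ i, MvPolynomial.pderiv i (MvPolynomial.pderiv i p)

/-- A coefficient vector (linear form) is isotropic if `∑ aᵢ² = 0`. -/
def Isotropic {n : ℕ} (a : Fin n → ℂ) : Prop :=
  ∑ i, (a i) ^ 2 = 0

/-- Isotropic rank: least `r` such that `h` is a sum of `r` `d`-th powers of
isotropic linear forms. -/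
noncomputable def irk {n : ℕ} (d : ℕ) (h : MvPolynomial (Fin n) ℂ) : ℕ :=
  sInf {r : ℕ | ∃ ℓ : Fin r → (Fin n → ℂ),
    (∀ j, Isotropic (ℓ j)) ∧ h = ∑ j, (lin (ℓ j)) ^ d}

/-- Waring rank: least `r` such that `h` is a sum of `r` `d`-th powers of
linear forms. -/
noncomputable def wrk {n : ℕ} (d : ℕ) (h : MvPolynomial (Fin n) ℂ) : ℕ :=
  sInf {r : ℕ | ∃ ℓ : Fin r → (Fin n → ℂ), h = ∑ j, (lin (ℓ j)) ^ d}


/-- Functions on the index set given by evaluating forms of degree `e` at the points `a j`. -/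
inductive HomFn {ι : Type} {m : ℕ} (a : ι → (Fin m → ℂ)) : ℕ → (ι → ℂ) → Prop
  | const (c : ℂ) : HomFn a 0 (fun _ => c)
  | zero (e : ℕ) : HomFn a e (fun _ => 0)
  | mul (e : ℕ) (f : ι → ℂ) (y : Fin m → ℂ) (hf : HomFn a e f) :
      HomFn a (e + 1) (fun j => (a j ⬝ᵥ y) * f j)
  | add (e : ℕ) (f g : ι → ℂ) (hf : HomFn a e f) (hg : HomFn a e g) :
      HomFn a e (fun j => f j + g j)
  | smul (e : ℕ) (c : ℂ) (f : ι → ℂ) (hf : HomFn a e f) : HomFn a e (fun j => c * f j)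

theorem HomFn.sum {ι : Type} {m : ℕ} {a : ι → (Fin m → ℂ)} {e : ℕ} {κ : Type}
    (s : Finset κ) (f : κ → ι → ℂ) (hf : ∀ i, HomFn a e (f i)) :
    HomFn a e (fun j => ∑ i ∈ s, f i j) := by
  classical
  induction s using Finset.induction_on with
  | empty => simpa using HomFn.zero e
  | insert i s hi ih =>
    simp only [Finset.sum_insert hi]
    exact HomFn.add _ _ _ (hf i) ih

theorem HomFn.quad {ι : Type} {m : ℕ} {a : ι → (Fin m → ℂ)} {e : ℕ} {f : ι → ℂ}
    (hf : HomFn a e f) : HomFn a (e + 2) (fun j => (a j ⬝ᵥ a j) * f j) := by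
  have h := HomFn.sum Finset.univ
    (fun (i : Fin m) j => (a j ⬝ᵥ Pi.single i 1) * ((a j ⬝ᵥ Pi.single i 1) * f j))
    (fun i => HomFn.mul _ _ _ (HomFn.mul _ _ _ hf))
  convert h using 2 with j
  simp [dotProduct, Finset.sum_mul, Pi.single_apply, mul_assoc]

theorem pderiv_lin {m : ℕ} (a : Fin m → ℂ) (i : Fin m) : pderiv i (lin a) = C (a i) := by
  classical
  simp [lin, pderiv_X, Pi.single_apply, Derivation.leibniz]

theorem eval_lin {m : ℕ} (a y : Fin m → ℂ) : eval y (lin a) = a ⬝ᵥ y := by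
  simp [lin, dotProduct]

theorem HomFn.apolar {ι : Type} [Fintype ι] {m : ℕ} {a : ι → (Fin m → ℂ)} {e : ℕ} {f : ι → ℂ}
    (hf : HomFn a e f) : ∀ c : ι → ℂ, ∑ j, C (c j) * lin (a j) ^ e = 0 → ∑ j, c j * f j = 0 := by
  induction hf with
  | const k =>
    intro c hc
    have := congrArg (eval 0) hc
    simp at this
    rw [← Finset.sum_mul, this, zero_mul]
  | zero e => intro c _; simp
  | mul e f y hf ih =>
    intro c hc
    have key := ih (fun j => c j * (a j ⬝ᵥ y)) ?_
    · rw [← key]; exact Finset.sum_congr rfl fun j _ => by ring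
    · have h1 : ∀ i, ∑ j, C (c j * a j i) * lin (a j) ^ e = 0 := by
        intro i
        have h2 := congrArg (pderiv i) hc
        simp only [map_sum, map_zero, Derivation.leibniz, Derivation.leibniz_pow, pderiv_C,
          pderiv_lin, smul_zero, add_zero, smul_eq_mul, nsmul_eq_mul, Nat.add_sub_cancel] at h2
        have h3 : ((e + 1 : ℕ) : MvPolynomial (Fin _) ℂ) *
            ∑ j, C (c j * a j i) * lin (a j) ^ e = 0 := by
          rw [← h2, Finset.mul_sum]
          exact Finset.sum_congr rfl fun j _ => by rw [C_mul]; ring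
        exact (mul_eq_zero.mp h3).resolve_left (Nat.cast_ne_zero.mpr (Nat.succ_ne_zero e))
      have h4 : ∑ i, C (y i) * ∑ j, C (c j * a j i) * lin (a j) ^ e = 0 := by
        simp only [h1, mul_zero, Finset.sum_const_zero]
      rw [← h4]
      simp only [Finset.mul_sum]
      rw [Finset.sum_comm]
      refine Finset.sum_congr rfl fun j _ => ?_
      simp only [dotProduct, Finset.mul_sum, map_sum, Finset.sum_mul, C_mul]
      exact Finset.sum_congr rfl fun i _ => by ring
  | add e f g hf hg ihf ihg =>
    intro c hc
    simp only [mul_add, Finset.sum_add_distrib, ihf c hc, ihg c hc, add_zero]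
  | smul e k f hf ih =>
    intro c hc
    have := ih c hc
    calc ∑ j, c j * (k * f j) = k * ∑ j, c j * f j := by
          rw [Finset.mul_sum]; exact Finset.sum_congr rfl fun j _ => by ring
      _ = 0 := by rw [this, mul_zero]

theorem HomFn.pow {ι : Type} {m : ℕ} (a : ι → (Fin m → ℂ)) (y : Fin m → ℂ) (e : ℕ) :
    HomFn a e (fun j => (a j ⬝ᵥ y) ^ e) := by
  induction e with
  | zero => simpa using HomFn.const 1
  | succ e ih => simpa [pow_succ'] using HomFn.mul _ _ y ih

/-- The division of `y ^ e` by the quadric, in terms of Cauchy data along `v`. -/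
theorem division {ι : Type} {m : ℕ} (a : ι → (Fin m → ℂ)) (v y : Fin m → ℂ) (e : ℕ) :
    ∃ O F' F : ι → ℂ, HomFn a e O ∧ HomFn a (e + 1) (fun j => (a j ⬝ᵥ a j) * F' j) ∧
      HomFn a e F ∧ ∀ j t M, t ^ 2 = (a j ⬝ᵥ v) ^ 2 - a j ⬝ᵥ a j →
        M = a j ⬝ᵥ y - (v ⬝ᵥ y) * (a j ⬝ᵥ v) →
        ((M + t * (v ⬝ᵥ y)) ^ (e + 1) - (M - t * (v ⬝ᵥ y)) ^ (e + 1) = 2 * t * O j) ∧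
        (2 * t * (a j ⬝ᵥ y) ^ (e + 1) - (t + a j ⬝ᵥ v) * (M + t * (v ⬝ᵥ y)) ^ (e + 1)
          - (t - a j ⬝ᵥ v) * (M - t * (v ⬝ᵥ y)) ^ (e + 1) = 2 * t * ((a j ⬝ᵥ a j) * F' j)) ∧
        (2 * t * (a j ⬝ᵥ y) ^ (e + 2) - (t + a j ⬝ᵥ v) * (M + t * (v ⬝ᵥ y)) ^ (e + 2)
          - (t - a j ⬝ᵥ v) * (M - t * (v ⬝ᵥ y)) ^ (e + 2) = 2 * t * ((a j ⬝ᵥ a j) * F j)) := by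
  induction e with
  | zero =>
    refine ⟨fun _ => v ⬝ᵥ y, fun _ => 0, fun _ => (v ⬝ᵥ y) ^ 2, HomFn.const _, ?_,
      HomFn.const _, ?_⟩
    · simpa using HomFn.zero 1
    · intro j t M ht hM
      generalize a j ⬝ᵥ y = x at *
      generalize a j ⬝ᵥ v = s at *
      generalize a j ⬝ᵥ a j = q at *
      generalize v ⬝ᵥ y = σ at *
      have hq : q = s ^ 2 - t ^ 2 := by rw [ht]; ring
      subst hM hq
      refine ⟨by ring, by ring, by ring⟩
  | succ e ih =>
    obtain ⟨O, F', F, hO, hF', hF, H⟩ := ih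
    set σ := v ⬝ᵥ y with hσ
    have hO2 : HomFn a (e + 1) (fun j => (((a j ⬝ᵥ y) * O j + (-2 * σ) * ((a j ⬝ᵥ v) * O j))
        + σ * (a j ⬝ᵥ y) ^ (e + 1)) + (-σ) * ((a j ⬝ᵥ a j) * F' j)) :=
      HomFn.add _ _ _ (HomFn.add _ _ _ (HomFn.add _ _ _ (HomFn.mul _ _ _ hO)
        (HomFn.smul _ _ _ (HomFn.mul _ _ _ hO))) (HomFn.smul _ _ _ (HomFn.pow a y (e + 1))))
        (HomFn.smul _ _ _ hF')
    refine ⟨_, F, _, hO2, HomFn.quad hF,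
      HomFn.add _ _ _ (HomFn.mul _ _ y hF) (HomFn.smul _ σ _ hO2), ?_⟩
    intro j t M ht hM
    obtain ⟨h1, h2, h3⟩ := H j t M ht hM
    generalize a j ⬝ᵥ y = x at *
    generalize a j ⬝ᵥ v = s at *
    generalize a j ⬝ᵥ a j = q at *
    have g1 : (M + t * σ) ^ (e + 1 + 1) - (M - t * σ) ^ (e + 1 + 1) = 2 * t *
        (((x * O j + (-2 * σ) * (s * O j)) + σ * x ^ (e + 1)) + (-σ) * (q * F' j)) := by
      rw [pow_succ (M + t * σ) (e + 1), pow_succ (M - t * σ) (e + 1)]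
      generalize (M + t * σ) ^ (e + 1) = P at *
      generalize (M - t * σ) ^ (e + 1) = N at *
      generalize x ^ (e + 1) = X at *
      subst hM
      linear_combination (x - 2 * σ * s) * h1 - σ * h2
    refine ⟨g1, h3, ?_⟩
    have e1 : ∀ z : ℂ, z ^ (e + 1 + 2) = z ^ (e + 2) * z := fun z => by ring
    have e2 : ∀ z : ℂ, z ^ (e + 1 + 1) = z ^ (e + 2) := fun z => by ring
    simp only [e1, e2] at g1 ⊢
    generalize (((x * O j + (-2 * σ) * (s * O j)) + σ * x ^ (e + 1)) + (-σ) * (q * F' j)) = O2 at *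
    generalize (M + t * σ) ^ (e + 2) = P at *
    generalize (M - t * σ) ^ (e + 2) = N at *
    generalize x ^ (e + 2) = X at *
    have hq : q = s ^ 2 - t ^ 2 := by rw [ht]; ring
    subst hM hq
    linear_combination x * h3 + (s ^ 2 - t ^ 2) * σ * g1

theorem exists_direction {ι : Type} [Fintype ι] {n : ℕ} (hn : 1 ≤ n)
    (a : ι → (Fin (n + 1) → ℂ)) :
    ∃ v : Fin (n + 1) → ℂ, v ⬝ᵥ v = 1 ∧
      ∀ j, a j ⬝ᵥ a j ≠ 0 → (a j ⬝ᵥ v) ^ 2 - a j ⬝ᵥ a j ≠ 0 := by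
  classical
  let Q : MvPolynomial (Fin (n + 1)) ℂ := ∑ i, X i * X i
  have hQ : ∀ v, eval v Q = v ⬝ᵥ v := fun v => by simp [Q, dotProduct]
  let R : ι → MvPolynomial (Fin (n + 1)) ℂ := fun j =>
    if a j ⬝ᵥ a j = 0 then 1 else lin (a j) ^ 2 - C (a j ⬝ᵥ a j) * Q
  have hR : ∀ j, R j ≠ 0 := by
    intro j
    by_cases h : a j ⬝ᵥ a j = 0
    · simp [R, h]
    · intro h0
      simp only [R, if_neg h] at h0
      have hv : ∀ v, (a j ⬝ᵥ v) ^ 2 = (a j ⬝ᵥ a j) * (v ⬝ᵥ v) := by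
        intro v
        have := congrArg (eval v) h0
        simp only [map_sub, map_pow, map_mul, eval_lin, eval_C, hQ, map_zero] at this
        linear_combination this
      have hne : (0 : Fin (n + 1)) ≠ Fin.last n := by
        intro hh
        have := congrArg Fin.val hh
        simp at this
        omega
      have h1 := hv (Pi.single 0 1)
      have h2 := hv (Pi.single (Fin.last n) 1)
      have h3 := hv (Pi.single 0 1 + Pi.single (Fin.last n) 1)
      simp [dotProduct_add, add_dotProduct, hne, hne.symm] at h1 h2 h3
      apply h
      generalize a j ⬝ᵥ a j = q at *
      have h4 : a j 0 * a j (Fin.last n) = 0 := by linear_combination (h3 - h1 - h2) / 2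
      have : q * q = 0 := by
        rw [← h1]
        rcases mul_eq_zero.mp h4 with h5 | h5
        · simp [h5]
        · rw [h1, ← h2]; simp [h5]
      exact mul_self_eq_zero.mp this
  have hQ0 : Q ≠ 0 := by
    intro h
    have := hQ (Pi.single 0 1)
    simp [h] at this
  have hprod : Q * ∏ j, R j ≠ 0 := mul_ne_zero hQ0 (Finset.prod_ne_zero_iff.mpr fun j _ => hR j)
  obtain ⟨u, hu⟩ : ∃ u, eval u (Q * ∏ j, R j) ≠ 0 := by
    by_contra! hcon
    exact hprod (MvPolynomial.funext fun u => by simpa using hcon u)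
  rw [map_mul, map_prod] at hu
  have hu1 : u ⬝ᵥ u ≠ 0 := by rw [← hQ]; exact left_ne_zero_of_mul hu
  have hu2 := Finset.prod_ne_zero_iff.mp (right_ne_zero_of_mul hu)
  obtain ⟨z, hz⟩ := IsAlgClosed.exists_pow_nat_eq (u ⬝ᵥ u) (n := 2) (by norm_num)
  have hz0 : z ≠ 0 := by rintro rfl; apply hu1; rw [← hz]; simp
  refine ⟨z⁻¹ • u, ?_, ?_⟩
  · simp only [smul_dotProduct, dotProduct_smul, smul_eq_mul, ← hz]
    field_simp
  · intro j hj hcon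
    apply hu2 j (Finset.mem_univ _)
    simp only [R, if_neg hj, map_sub, map_pow, map_mul, eval_lin, eval_C, hQ]
    simp only [dotProduct_smul, smul_eq_mul] at hcon
    rw [← hz]
    field_simp at hcon
    linear_combination hcon

theorem lin_smul {m : ℕ} (c : ℂ) (a : Fin m → ℂ) : lin (c • a) = C c * lin a := by
  simp [lin, Finset.mul_sum, mul_assoc]

theorem isotropic_iff {m : ℕ} (a : Fin m → ℂ) : Isotropic a ↔ a ⬝ᵥ a = 0 := by
  simp [Isotropic, dotProduct, pow_two]

theorem lap_dec {ι : Type} [Fintype ι] {m : ℕ} (a : ι → (Fin m → ℂ)) (e : ℕ)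
    (h : lap (∑ j, lin (a j) ^ (e + 2)) = 0) :
    ∑ j, C (a j ⬝ᵥ a j) * lin (a j) ^ e = 0 := by
  have h1 : (((e + 2 : ℕ) * (e + 1 : ℕ) : ℕ) : MvPolynomial (Fin m) ℂ) *
      ∑ j, C (a j ⬝ᵥ a j) * lin (a j) ^ e = 0 := by
    rw [← h]
    simp only [lap, map_sum]
    rw [Finset.sum_comm, Finset.mul_sum]
    refine Finset.sum_congr rfl fun j _ => ?_
    simp only [dotProduct, map_sum, Finset.sum_mul, Finset.mul_sum]
    refine Finset.sum_congr rfl fun i _ => ?_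
    have e1 : e + 2 - 1 = e + 1 := rfl
    simp only [Derivation.leibniz, Derivation.leibniz_pow, pderiv_C, pderiv_lin, smul_zero,
      add_zero, zero_add, smul_eq_mul, nsmul_eq_mul, e1, Nat.add_sub_cancel, C_mul,
      Derivation.map_natCast, map_nsmul]
    push_cast
    ring
  exact (mul_eq_zero.mp h1).resolve_left (Nat.cast_ne_zero.mpr (by positivity))

theorem irk_le_card {ι : Type} [Fintype ι] {m d : ℕ} (h : MvPolynomial (Fin m) ℂ)
    (b : ι → (Fin m → ℂ)) (hb : ∀ i, Isotropic (b i)) (hs : h = ∑ i, lin (b i) ^ d) :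
    irk d h ≤ Fintype.card ι := by
  apply Nat.sInf_le
  refine ⟨fun j => b ((Fintype.equivFin ι).symm j), fun j => hb _, ?_⟩
  rw [hs]
  exact (Equiv.sum_comp (Fintype.equivFin ι).symm (fun i => lin (b i) ^ d)).symm

theorem split_dec {ι : Type} [Fintype ι] {n d : ℕ} (hn : 1 ≤ n) (hd : 1 ≤ d)
    (a : ι → (Fin (n + 1) → ℂ)) (hh : lap (∑ j, lin (a j) ^ d) = 0) :
    ∃ b b' : ι → (Fin (n + 1) → ℂ), (∀ j, Isotropic (b j)) ∧ (∀ j, Isotropic (b' j)) ∧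
      (∀ j, Isotropic (a j) → b' j = 0) ∧
      ∑ j, lin (a j) ^ d = ∑ j, (lin (b j) ^ d + lin (b' j) ^ d) := by
  classical
  obtain ⟨v, hv, hav⟩ := exists_direction hn a
  -- division function
  have hdiv : ∀ y, ∃ F : ι → ℂ, ∑ j, (a j ⬝ᵥ a j) * F j = 0 ∧
      ∀ j t M, t ^ 2 = (a j ⬝ᵥ v) ^ 2 - a j ⬝ᵥ a j →
        M = a j ⬝ᵥ y - (v ⬝ᵥ y) * (a j ⬝ᵥ v) →
        (2 * t * (a j ⬝ᵥ y) ^ d - (t + a j ⬝ᵥ v) * (M + t * (v ⬝ᵥ y)) ^ d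
          - (t - a j ⬝ᵥ v) * (M - t * (v ⬝ᵥ y)) ^ d = 2 * t * ((a j ⬝ᵥ a j) * F j)) := by
    intro y
    obtain rfl | ⟨e, rfl⟩ : d = 1 ∨ ∃ e, d = e + 2 := by
      rcases Nat.lt_or_ge d 2 with h | h
      · left; omega
      · right; exact ⟨d - 2, by omega⟩
    · refine ⟨fun _ => 0, by simp, ?_⟩
      intro j t M _ hM
      subst hM
      ring
    · obtain ⟨_, _, F, _, _, hF, H⟩ := division a v y e
      exact ⟨F, hF.apolar _ (lap_dec a e hh), fun j t M h1 h2 => (H j t M h1 h2).2.2⟩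
  have hpt : ∀ j, ∃ b b' : Fin (n + 1) → ℂ, Isotropic b ∧ Isotropic b' ∧
      (Isotropic (a j) → b' = 0) ∧ ∀ y (F : ι → ℂ), (∀ t M, t ^ 2 = (a j ⬝ᵥ v) ^ 2 - a j ⬝ᵥ a j →
        M = a j ⬝ᵥ y - (v ⬝ᵥ y) * (a j ⬝ᵥ v) →
        (2 * t * (a j ⬝ᵥ y) ^ d - (t + a j ⬝ᵥ v) * (M + t * (v ⬝ᵥ y)) ^ d
          - (t - a j ⬝ᵥ v) * (M - t * (v ⬝ᵥ y)) ^ d = 2 * t * ((a j ⬝ᵥ a j) * F j))) →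
        (a j ⬝ᵥ y) ^ d = (b ⬝ᵥ y) ^ d + (b' ⬝ᵥ y) ^ d + (a j ⬝ᵥ a j) * F j := by
    intro j
    by_cases hj : a j ⬝ᵥ a j = 0
    · refine ⟨a j, 0, (isotropic_iff _).2 hj, (isotropic_iff _).2 (by simp), fun _ => rfl, ?_⟩
      intro y F _
      have : d ≠ 0 := by omega
      simp [hj, this]
    · obtain ⟨t, ht⟩ := IsAlgClosed.exists_pow_nat_eq ((a j ⬝ᵥ v) ^ 2 - a j ⬝ᵥ a j) (n := 2)
        (by norm_num)
      have ht0 : t ≠ 0 := by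
        rintro rfl
        exact hav j hj (by rw [← ht]; simp)
      obtain ⟨w, hw⟩ := IsAlgClosed.exists_pow_nat_eq ((t + a j ⬝ᵥ v) / (2 * t)) (n := d) hd
      obtain ⟨w', hw'⟩ := IsAlgClosed.exists_pow_nat_eq ((t - a j ⬝ᵥ v) / (2 * t)) (n := d) hd
      have hiso : ∀ w τ : ℂ, τ ^ 2 = t ^ 2 →
          Isotropic (w • (a j + (τ - a j ⬝ᵥ v) • v)) := by
        intro w τ hτ
        rw [isotropic_iff]
        simp only [smul_dotProduct, dotProduct_smul, add_dotProduct, dotProduct_add, smul_eq_mul,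
          hv, dotProduct_comm v (a j)]
        rw [ht] at hτ
        linear_combination w ^ 2 * hτ
      refine ⟨w • (a j + (t - a j ⬝ᵥ v) • v), w' • (a j + (-t - a j ⬝ᵥ v) • v),
        hiso _ _ rfl, hiso _ _ (by ring), fun h => absurd ((isotropic_iff _).1 h) hj, ?_⟩
      intro y F H
      have H1 := H t _ ht rfl
      simp only [smul_dotProduct, add_dotProduct, smul_eq_mul, mul_pow, hw, hw']
      have r1 : a j ⬝ᵥ y + (t - a j ⬝ᵥ v) * (v ⬝ᵥ y) =
        a j ⬝ᵥ y - (v ⬝ᵥ y) * (a j ⬝ᵥ v) + t * (v ⬝ᵥ y) := by ring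
      have r2 : a j ⬝ᵥ y + (-t - a j ⬝ᵥ v) * (v ⬝ᵥ y) =
        a j ⬝ᵥ y - (v ⬝ᵥ y) * (a j ⬝ᵥ v) - t * (v ⬝ᵥ y) := by ring
      rw [r1, r2]
      field_simp
      linear_combination H1
  choose b b' h1 h2 h3 h4 using hpt
  refine ⟨b, b', h1, h2, h3, ?_⟩
  apply MvPolynomial.funext
  intro y
  obtain ⟨F, hF0, hF⟩ := hdiv y
  simp only [map_sum, map_add, map_pow, eval_lin]
  rw [Finset.sum_congr rfl fun j _ => h4 j y F (hF j), Finset.sum_add_distrib, hF0, add_zero]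

/-- If a minimal Waring decomposition of a harmonic form `h` contains `k`
isotropic linear forms, then `irk h ≤ 2 · rk h − k`. -/
theorem stmt3 (n d r k : ℕ) (hn : 1 ≤ n) (hd : 1 ≤ d)
    (h : MvPolynomial (Fin (n + 1)) ℂ) (h0 : h ≠ 0)
    (hharm : lap h = 0) (hhom : h.IsHomogeneous d)
    (hrk : wrk d h = r) (hkr : k ≤ r)
    (ℓ : Fin r → (Fin (n + 1) → ℂ))
    (hdec : h = ∑ j, (lin (ℓ j)) ^ d)
    (hiso : ∀ j : Fin r, (j : ℕ) < k → Isotropic (ℓ j)) :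
    irk d h ≤ 2 * r - k := by
  subst hdec
  obtain ⟨b, b', h1, h2, h3, h4⟩ := split_dec hn hd ℓ hharm
  have hcard : Fintype.card (Fin r ⊕ {j : Fin r // ¬ (j : ℕ) < k}) = 2 * r - k := by
    rw [Fintype.card_sum, Fintype.card_subtype_compl, Fintype.card_fin]
    have : Fintype.card {j : Fin r // (j : ℕ) < k} = k := by
      rw [Fintype.card_subtype, Fin.card_filter_val_lt]
      omega
    omega
  rw [← hcard]
  apply irk_le_card _ (Sum.elim b (fun j => b' j.1))
  · rintro (j | j)
    · exact h1 j
    · exact h2 _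
  · rw [h4, Fintype.sum_sum_type, Finset.sum_add_distrib]
    simp only [Sum.elim_inl, Sum.elim_inr]
    congr 1
    rw [← Fintype.sum_subtype_add_sum_subtype (fun j : Fin r => (j : ℕ) < k)
      (fun j => lin (b' j) ^ d)]
    rw [Finset.sum_eq_zero, zero_add]
    intro j _
    rw [h3 j.1 (hiso j.1 j.2)]
    have : d ≠ 0 := by omega
    simp [lin, this]
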